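/- Let (v₁, v₂, v₃) be an orthonormal basis of ℝ³, let 0 < λ < λ₃, and set M := λ(v₁v₁ᵀ + v₂v₂ᵀ) + λ₃v₃v₃ᵀ. Let u ∈ ℝ³ be a unit vector such that 0 < 1 − ⟨u, v₃⟩² < 2λ/(λ + λ₃). Then for every unit vector v ∈ ℝ³ that is an eigenvector of M and every ψ ∈ (0, 2π), tr(M(I − R_a(π,v)·R_a(ψ,u))) < tr(M(I − R_a(π,v))). -/

import Mathlib

open Matrix Real

noncomputable section

/-- The hat map: u^∧ y = u × y. -/
def hat (u : Fin 3 → ℝ) : Matrix (Fin 3) (Fin 3) ℝ :=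
  !![0, -u 2, u 1; u 2, 0, -u 0; -u 1, u 0, 0]

/-- The Rodrigues rotation R_a(θ, u) = I + sin θ · u^∧ + (1 − cos θ)·(u^∧)². -/
def Ra (θ : ℝ) (u : Fin 3 → ℝ) : Matrix (Fin 3) (Fin 3) ℝ :=
  1 + Real.sin θ • hat u + (1 - Real.cos θ) • (hat u * hat u)

theorem hat_mul_hat {u : Fin 3 → ℝ} (hu : u ⬝ᵥ u = 1) :
    hat u * hat u = vecMulVec u u - 1 := by
  have h : u 0 * u 0 + u 1 * u 1 + u 2 * u 2 = 1 := by
    simpa [dotProduct, Fin.sum_univ_three] using hu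
  ext i j
  fin_cases i <;> fin_cases j <;>
    simp [hat, Matrix.mul_apply, Fin.sum_univ_three, vecMulVec_apply] <;> linarith

theorem Ra_pi {v : Fin 3 → ℝ} (hv : v ⬝ᵥ v = 1) :
    Ra π v = (2 : ℝ) • vecMulVec v v - 1 := by
  rw [Ra, hat_mul_hat hv, Real.sin_pi, Real.cos_pi]
  module

theorem trace_mul_hat {N : Matrix (Fin 3) (Fin 3) ℝ} (hN : N.IsSymm) (u : Fin 3 → ℝ) :
    (N * hat u).trace = 0 := by
  simp only [hat, Matrix.trace_fin_three, Matrix.mul_apply, Fin.sum_univ_three]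
  simp
  linear_combination u 2 * hN.apply 1 0 + u 1 * hN.apply 0 2 + u 0 * hN.apply 2 1

theorem trace_mul_Ra {N : Matrix (Fin 3) (Fin 3) ℝ} (hN : N.IsSymm) (ψ : ℝ)
    {u : Fin 3 → ℝ} (hu : u ⬝ᵥ u = 1) :
    (N * Ra ψ u).trace = N.trace + (1 - Real.cos ψ) * (u ⬝ᵥ N *ᵥ u - N.trace) := by
  rw [Ra, hat_mul_hat hu]
  simp only [mul_add, mul_sub, Matrix.mul_smul, mul_one, Matrix.trace_add, Matrix.trace_smul,
    Matrix.trace_sub, trace_mul_hat hN, mul_vecMulVec, trace_vecMulVec, smul_eq_mul]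
  rw [dotProduct_comm]
  ring

theorem sum_vecMulVec_of_orthonormal {v₁ v₂ v₃ : Fin 3 → ℝ}
    (h11 : v₁ ⬝ᵥ v₁ = 1) (h22 : v₂ ⬝ᵥ v₂ = 1) (h33 : v₃ ⬝ᵥ v₃ = 1)
    (h12 : v₁ ⬝ᵥ v₂ = 0) (h13 : v₁ ⬝ᵥ v₃ = 0) (h23 : v₂ ⬝ᵥ v₃ = 0) :
    vecMulVec v₁ v₁ + vecMulVec v₂ v₂ + vecMulVec v₃ v₃ = 1 := by
  let A : Matrix (Fin 3) (Fin 3) ℝ := Matrix.of ![v₁, v₂, v₃]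
  have hA : A * Aᵀ = 1 := by
    ext i j
    change ![v₁, v₂, v₃] i ⬝ᵥ ![v₁, v₂, v₃] j = _
    fin_cases i <;> fin_cases j <;>
      simp [h11, h22, h33, h12, h13, h23, dotProduct_comm v₂ v₁, dotProduct_comm v₃]
  rw [← mul_eq_one_comm.mp hA]
  ext i j
  simp [A, Matrix.mul_apply, Fin.sum_univ_three, vecMulVec_apply]

theorem trace_lt_of_eigenvector {M : Matrix (Fin 3) (Fin 3) ℝ} (hM : M.IsSymm)
    {u v : Fin 3 → ℝ} (hu : u ⬝ᵥ u = 1) (hv : v ⬝ᵥ v = 1) {μ : ℝ} (hμ : M *ᵥ v = μ • v)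
    (hpos : 0 < M.trace - u ⬝ᵥ M *ᵥ u - 2 * μ * (1 - (u ⬝ᵥ v) ^ 2))
    {ψ : ℝ} (hψ : ψ ∈ Set.Ioo (0 : ℝ) (2 * π)) :
    (M * (1 - Ra π v * Ra ψ u)).trace < (M * (1 - Ra π v)).trace := by
  have hcos : 0 < 1 - Real.cos ψ := by
    refine sub_pos.2 (lt_of_le_of_ne (Real.cos_le_one ψ) fun h => hψ.1.ne' ?_)
    exact (Real.cos_eq_one_iff_of_lt_of_lt (by linarith [hψ.1, Real.pi_pos]) hψ.2).1 h
  have hN : M * Ra π v = (2 * μ) • vecMulVec v v - M := by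
    rw [Ra_pi hv, mul_sub, mul_one, Matrix.mul_smul, mul_vecMulVec, hμ, smul_vecMulVec,
      smul_smul]
  have hsymm : ((2 * μ) • vecMulVec v v - M).IsSymm := by
    rw [Matrix.IsSymm, transpose_sub, transpose_smul, transpose_vecMulVec, hM.eq]
  have hquad : u ⬝ᵥ ((2 * μ) • vecMulVec v v - M) *ᵥ u
      = 2 * μ * (u ⬝ᵥ v) ^ 2 - u ⬝ᵥ M *ᵥ u := by
    simp only [sub_mulVec, smul_mulVec, vecMulVec_mulVec, op_smul_eq_smul, dotProduct_sub,
      dotProduct_smul, smul_eq_mul, dotProduct_comm v u]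
    ring
  have htrace : ((2 * μ) • vecMulVec v v - M).trace = 2 * μ - M.trace := by
    simp [trace_vecMulVec, hv]
  rw [mul_sub, mul_sub, ← mul_assoc, hN, trace_sub, trace_sub, trace_mul_Ra hsymm ψ hu,
    hquad, htrace]
  have := mul_pos hcos hpos
  linarith

/-- Synergy condition (Theorem 1, case 4): for M with eigenvalues
0 < λ = λ₁ = λ₂ < λ₃ and a warping direction u with
0 < 1 − ⟨u,v₃⟩² < 2λ/(λ + λ₃), the warped potential strictly decreases at
every unwanted critical point. -/
theorem synergy_case_repeated_min_eigenvalue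
    (v₁ v₂ v₃ : Fin 3 → ℝ)
    (h11 : v₁ ⬝ᵥ v₁ = 1) (h22 : v₂ ⬝ᵥ v₂ = 1) (h33 : v₃ ⬝ᵥ v₃ = 1)
    (h12 : v₁ ⬝ᵥ v₂ = 0) (h13 : v₁ ⬝ᵥ v₃ = 0) (h23 : v₂ ⬝ᵥ v₃ = 0)
    (lam l₃ : ℝ) (hlam : 0 < lam) (hl₃ : lam < l₃)
    (M : Matrix (Fin 3) (Fin 3) ℝ)
    (hMdef : M = lam • (vecMulVec v₁ v₁ + vecMulVec v₂ v₂) + l₃ • vecMulVec v₃ v₃)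
    (u : Fin 3 → ℝ) (hu : u ⬝ᵥ u = 1)
    (hcond1 : 0 < 1 - (u ⬝ᵥ v₃)^2)
    (hcond2 : 1 - (u ⬝ᵥ v₃)^2 < 2 * lam / (lam + l₃)) :
    ∀ v : Fin 3 → ℝ, v ⬝ᵥ v = 1 → (∃ μ : ℝ, M *ᵥ v = μ • v) →
      ∀ ψ ∈ Set.Ioo (0 : ℝ) (2 * π),
        (M * (1 - Ra π v * Ra ψ u)).trace < (M * (1 - Ra π v)).trace := by
  rintro v hv ⟨μ, hμ⟩ ψ hψ
  have hM : M = lam • (1 : Matrix (Fin 3) (Fin 3) ℝ) + (l₃ - lam) • vecMulVec v₃ v₃ := by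
    rw [hMdef, ← sum_vecMulVec_of_orthonormal h11 h22 h33 h12 h13 h23]
    module
  have hMv (w : Fin 3 → ℝ) : M *ᵥ w = lam • w + ((l₃ - lam) * (w ⬝ᵥ v₃)) • v₃ := by
    rw [hM, add_mulVec, smul_mulVec, smul_mulVec, one_mulVec, vecMulVec_mulVec,
      op_smul_eq_smul, smul_smul, dotProduct_comm v₃]
  have hsymm : M.IsSymm := by
    rw [hM, Matrix.IsSymm, transpose_add, transpose_smul, transpose_smul, transpose_one,
      transpose_vecMulVec]
  have htrace : M.trace = 2 * lam + l₃ := by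
    rw [hM]
    simp [trace_vecMulVec, h33]
    ring
  have hquad : u ⬝ᵥ M *ᵥ u = lam + (l₃ - lam) * (u ⬝ᵥ v₃) ^ 2 := by
    rw [hMv, dotProduct_add, dotProduct_smul, dotProduct_smul, hu, smul_eq_mul, smul_eq_mul]
    ring
  refine trace_lt_of_eigenvector hsymm hu hv hμ ?_ hψ
  rw [htrace, hquad]
  rw [hMv] at hμ
  have hμv : lam + (l₃ - lam) * (v ⬝ᵥ v₃) ^ 2 = μ := by
    have h := congrArg (v ⬝ᵥ ·) hμ
    simp only [dotProduct_add, dotProduct_smul, hv, smul_eq_mul] at h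
    linarith
  have hμv₃ : (l₃ - μ) * (v ⬝ᵥ v₃) = 0 := by
    have h := congrArg (· ⬝ᵥ v₃) hμ
    simp only [add_dotProduct, smul_dotProduct, h33, smul_eq_mul] at h
    linarith
  have hd : 0 < l₃ - lam := sub_pos.2 hl₃
  rcases mul_eq_zero.1 hμv₃ with h | h
  · obtain rfl : l₃ = μ := sub_eq_zero.1 h
    have ha : (v ⬝ᵥ v₃) ^ 2 = 1 := mul_left_cancel₀ hd.ne' (by linarith)
    have hvv₃ : v = (v ⬝ᵥ v₃) • v₃ := by
      refine smul_right_injective _ hd.ne' ?_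
      simp only [smul_smul]
      rw [sub_smul, ← hμ]
      module
    have huv : (u ⬝ᵥ v) ^ 2 = (u ⬝ᵥ v₃) ^ 2 := by
      conv_lhs => rw [hvv₃]
      rw [dotProduct_smul, smul_eq_mul, mul_pow, ha, one_mul]
    rw [lt_div_iff₀ (by linarith)] at hcond2
    rw [huv]
    linarith
  · rw [h] at hμv
    obtain rfl : lam = μ := by linarith
    nlinarith [mul_pos hd hcond1, mul_nonneg hlam.le (sq_nonneg (u ⬝ᵥ v))]

end
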